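/- Let x ∈ (0,1] and let f : [0,1] → ℝ be twice continuously differentiable on [0,1]. Then the limit as n → ∞ of n · ( B_{n,2}^{[1]}f(x) - f(x) ) equals (x(1-x)/2) · f''(x) - ((1-x)/2) · f'(x). -/

import Mathlib

open Filter Finset

/-- Bernstein basis polynomial `p_{n,k}(x) = C(n,k) x^k (1-x)^{n-k}`. -/
noncomputable def bern (n k : ℕ) (x : ℝ) : ℝ := (n.choose k : ℝ) * x ^ k * (1 - x) ^ (n - k)

/-- The AKR node `t_{n,k} = √(k(k-1)/(n(n-1)))`. -/
noncomputable def akrNode (n k : ℕ) : ℝ := Real.sqrt ((k * (k - 1)) / (n * (n - 1)))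

/-- The Aldaz–Kounchev–Render operator with `j = 2`:
`B_{n,2}^{[1]} f(x) = Σ_{k=0}^n f(t_{n,k}) p_{n,k}(x)`. -/
noncomputable def akrOp (n : ℕ) (f : ℝ → ℝ) (x : ℝ) : ℝ :=
  ∑ k ∈ Finset.range (n + 1), f (akrNode n k) * bern n k x

/-- The factorial moments of the binomial distribution. -/
lemma sum_descFactorial_mul_bern (j n : ℕ) (x : ℝ) :
    ∑ k ∈ range (n + 1), (k.descFactorial j : ℝ) * bern n k x = n.descFactorial j * x ^ j := by
  induction j generalizing n with
  | zero =>
    have h := add_pow x (1 - x) n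
    rw [add_sub_cancel, one_pow] at h
    simp only [Nat.descFactorial_zero, Nat.cast_one, one_mul, pow_zero, mul_one]
    rw [h]
    exact sum_congr rfl fun k _ => by unfold bern; ring
  | succ j ih =>
    cases n with
    | zero => simp
    | succ m =>
      rw [sum_range_succ', Nat.zero_descFactorial_succ, Nat.succ_descFactorial_succ]
      simp only [Nat.succ_descFactorial_succ, Nat.cast_zero, zero_mul, add_zero]
      calc ∑ k ∈ range (m + 1), (((k + 1) * k.descFactorial j : ℕ) : ℝ) * bern (m + 1) (k + 1) x
          = ∑ k ∈ range (m + 1), ((m + 1 : ℝ) * x) * ((k.descFactorial j : ℝ) * bern m k x) := by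
            refine sum_congr rfl fun k _ => ?_
            have h : ((m : ℝ) + 1) * (m.choose k : ℝ) = ((m + 1).choose (k + 1) : ℝ) * (k + 1) := by
              exact_mod_cast Nat.add_one_mul_choose_eq m k
            unfold bern
            rw [Nat.add_sub_add_right]
            push_cast
            linear_combination (-(k.descFactorial j : ℝ) * x ^ (k + 1) * (1 - x) ^ (m - k)) * h
        _ = _ := by
            rw [← mul_sum, ih]
            push_cast
            ring

lemma sum_bern (n : ℕ) (x : ℝ) : ∑ k ∈ range (n + 1), bern n k x = 1 := by
  simpa using sum_descFactorial_mul_bern 0 n x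

lemma bern_nonneg {n k : ℕ} {x : ℝ} (hx : x ∈ Set.Ioc (0 : ℝ) 1) : 0 ≤ bern n k x := by
  have h₀ := hx.1.le
  have h₁ : 0 ≤ 1 - x := sub_nonneg.2 hx.2
  unfold bern
  positivity

lemma cast_descFactorial_three (n : ℕ) :
    (n.descFactorial 3 : ℝ) = n * (n - 1) * (n - 2) := by
  rw [← descPochhammer_eval_eq_descFactorial]
  simp [descPochhammer_succ_right]

lemma cast_descFactorial_four (n : ℕ) :
    (n.descFactorial 4 : ℝ) = n * (n - 1) * (n - 2) * (n - 3) := by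
  rw [← descPochhammer_eval_eq_descFactorial]
  simp [descPochhammer_succ_right]

/-- The moments of a quartic polynomial written in the falling factorial basis. -/
lemma sum_quartic_mul_bern (n : ℕ) (x c₀ c₁ c₂ c₃ c₄ : ℝ) :
    ∑ k ∈ range (n + 1), (c₀ + c₁ * k + c₂ * (k * (k - 1)) + c₃ * (k * (k - 1) * (k - 2))
        + c₄ * (k * (k - 1) * (k - 2) * (k - 3))) * bern n k x
      = c₀ + c₁ * (n * x) + c₂ * (n * (n - 1) * x ^ 2) + c₃ * (n * (n - 1) * (n - 2) * x ^ 3)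
        + c₄ * (n * (n - 1) * (n - 2) * (n - 3) * x ^ 4) := by
  have h₁ := sum_descFactorial_mul_bern 1 n x
  have h₂ := sum_descFactorial_mul_bern 2 n x
  have h₃ := sum_descFactorial_mul_bern 3 n x
  have h₄ := sum_descFactorial_mul_bern 4 n x
  simp only [Nat.descFactorial_one, Nat.cast_descFactorial_two, cast_descFactorial_three,
    cast_descFactorial_four, pow_one] at h₁ h₂ h₃ h₄
  simp only [add_mul, sum_add_distrib, mul_assoc c₁, mul_assoc c₂, mul_assoc c₃,
    mul_assoc c₄, ← mul_sum, h₁, h₂, h₃, h₄, sum_bern, mul_one]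

lemma akrNode_sq_eq {n : ℕ} (hn : 2 ≤ n) (k : ℕ) :
    akrNode n k ^ 2 = (k * (k - 1)) / (n * (n - 1)) := by
  have hn' : (2 : ℝ) ≤ n := by exact_mod_cast hn
  have hk : (0 : ℝ) ≤ k * (k - 1) := by
    rw [← Nat.cast_descFactorial_two]
    positivity
  exact Real.sq_sqrt (div_nonneg hk (mul_nonneg (by linarith) (by linarith)))

lemma akrNode_mem_Icc {n k : ℕ} (hn : 2 ≤ n) (hk : k ≤ n) :
    akrNode n k ∈ Set.Icc (0 : ℝ) 1 := by
  have hn' : (2 : ℝ) ≤ n := by exact_mod_cast hn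
  refine ⟨Real.sqrt_nonneg _, Real.sqrt_le_one.2 (div_le_one_of_le₀ ?_ ?_)⟩
  · rw [← Nat.cast_descFactorial_two, ← Nat.cast_descFactorial_two]
    exact_mod_cast Nat.descFactorial_le 2 hk
  · exact mul_nonneg (by linarith) (by linarith)

lemma sum_akrNode_sq_sub {n : ℕ} (hn : 2 ≤ n) (x : ℝ) :
    ∑ k ∈ range (n + 1), (akrNode n k ^ 2 - x ^ 2) * bern n k x = 0 := by
  have hn' : (2 : ℝ) ≤ n := by exact_mod_cast hn
  have h₀ : (n : ℝ) ≠ 0 := by linarith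
  have h₁ : (n : ℝ) - 1 ≠ 0 := by linarith
  have h := sum_quartic_mul_bern n x (-x ^ 2) 0 (1 / (n * (n - 1))) 0 0
  simp only [akrNode_sq_eq hn]
  convert h using 1
  · exact sum_congr rfl fun k _ => by ring
  · field_simp
    ring

lemma mul_sum_akrNode_sq_sub_sq {n : ℕ} (hn : 2 ≤ n) (x : ℝ) :
    n * ∑ k ∈ range (n + 1), (akrNode n k ^ 2 - x ^ 2) ^ 2 * bern n k x
      = 4 * x ^ 3 * (1 - x) + (2 * x ^ 2 - 4 * x ^ 3 + 2 * x ^ 4) / (n - 1) := by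
  have hn' : (2 : ℝ) ≤ n := by exact_mod_cast hn
  have h₀ : (n : ℝ) ≠ 0 := by linarith
  have h₁ : (n : ℝ) - 1 ≠ 0 := by linarith
  have h := sum_quartic_mul_bern n x (x ^ 4) 0
    (2 / (n * (n - 1)) ^ 2 - 2 * x ^ 2 / (n * (n - 1)))
    (4 / (n * (n - 1)) ^ 2) (1 / (n * (n - 1)) ^ 2)
  simp only [akrNode_sq_eq hn]
  trans n * ∑ k ∈ range (n + 1), (x ^ 4 + 0 * k
        + (2 / (n * (n - 1)) ^ 2 - 2 * x ^ 2 / (n * (n - 1))) * (k * (k - 1))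
        + 4 / (n * (n - 1)) ^ 2 * (k * (k - 1) * (k - 2))
        + 1 / (n * (n - 1)) ^ 2 * (k * (k - 1) * (k - 2) * (k - 3))) * bern n k x
  · congr 1
    refine sum_congr rfl fun k _ => ?_
    field_simp
    ring
  · rw [h]
    field_simp
    ring

lemma sum_sub_pow_four_mul_bern (n : ℕ) (x : ℝ) :
    ∑ k ∈ range (n + 1), ((k : ℝ) - n * x) ^ 4 * bern n k x
      = n * (x * (1 - x)) * (1 + 3 * (n - 2) * (x * (1 - x))) := by
  have h := sum_quartic_mul_bern n x ((n * x) ^ 4)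
    (1 - 4 * (n * x) + 6 * (n * x) ^ 2 - 4 * (n * x) ^ 3)
    (7 - 12 * (n * x) + 6 * (n * x) ^ 2) (6 - 4 * (n * x)) 1
  convert h using 1
  · exact sum_congr rfl fun k _ => by ring
  · ring

lemma abs_akrNode_sq_sub_le {n k : ℕ} (hn : 2 ≤ n) (hk : k ≤ n) {x : ℝ}
    (hx : x ∈ Set.Ioc (0 : ℝ) 1) :
    |akrNode n k ^ 2 - x ^ 2| ≤ 2 * |k / n - x| + 1 / (n - 1) := by
  have hn' : (2 : ℝ) ≤ n := by exact_mod_cast hn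
  have hk' : (k : ℝ) ≤ n := by exact_mod_cast hk
  have hk₀ : (0 : ℝ) ≤ k := k.cast_nonneg
  have h₀ : (0 : ℝ) < n := by linarith
  have h₁ : (0 : ℝ) < n - 1 := by linarith
  have hq₀ : 0 ≤ (k : ℝ) / n := by positivity
  have hq₁ : (k : ℝ) / n ≤ 1 := (div_le_one h₀).2 hk'
  have e : akrNode n k ^ 2 - x ^ 2
      = (k / n - x) * (k / n + x) - (k / n) * (1 - k / n) * (1 / (n - 1)) := by
    rw [akrNode_sq_eq hn]
    field_simp
    ring
  have hi : 0 ≤ 1 / ((n : ℝ) - 1) := by positivity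
  have hp : 0 ≤ (k : ℝ) / n * (1 - k / n) := mul_nonneg hq₀ (by linarith)
  have hp₁ : (k : ℝ) / n * (1 - k / n) ≤ 1 := by nlinarith
  rw [e]
  refine (abs_sub _ _).trans (add_le_add ?_ ?_)
  · rw [abs_mul, mul_comm]
    refine mul_le_mul_of_nonneg_right ?_ (abs_nonneg _)
    rw [abs_of_nonneg (by linarith [hx.1])]
    linarith [hx.2]
  · rw [abs_of_nonneg (mul_nonneg hp hi)]
    exact mul_le_of_le_one_left hi hp₁

lemma mul_sum_akrNode_sq_sub_pow_four_le {n : ℕ} (hn : 2 ≤ n) {x : ℝ}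
    (hx : x ∈ Set.Ioc (0 : ℝ) 1) :
    n * ∑ k ∈ range (n + 1), (akrNode n k ^ 2 - x ^ 2) ^ 4 * bern n k x ≤ 528 / (n - 1) := by
  have hn' : (2 : ℝ) ≤ n := by exact_mod_cast hn
  have h₀ : (0 : ℝ) < n := by linarith
  have h₁ : (0 : ℝ) < n - 1 := by linarith
  have hx₀ : 0 ≤ x * (1 - x) := mul_nonneg hx.1.le (by linarith [hx.2])
  have hx₁ : x * (1 - x) ≤ 1 := by nlinarith [hx.1, hx.2]
  have key : ∑ k ∈ range (n + 1), (akrNode n k ^ 2 - x ^ 2) ^ 4 * bern n k x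
      ≤ 128 / n ^ 4 * ∑ k ∈ range (n + 1), ((k : ℝ) - n * x) ^ 4 * bern n k x
        + 8 / (n - 1) ^ 4 * ∑ k ∈ range (n + 1), bern n k x := by
    rw [mul_sum, mul_sum, ← sum_add_distrib]
    refine sum_le_sum fun k hk => ?_
    have hk' : k ≤ n := Nat.lt_succ_iff.1 (mem_range.1 hk)
    have hle := pow_le_pow_left₀ (abs_nonneg _) (abs_akrNode_sq_sub_le hn hk' hx) 4
    have hpow := add_pow_le (a := 2 * |(k : ℝ) / n - x|) (b := 1 / ((n : ℝ) - 1))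
      (by positivity) (by positivity) 4
    rw [(by decide : Even 4).pow_abs] at hle
    rw [mul_pow, (by decide : Even 4).pow_abs] at hpow
    have hkn : (k : ℝ) / n - x = (k - n * x) / n := by field_simp
    rw [hkn, div_pow, div_pow] at hpow
    calc (akrNode n k ^ 2 - x ^ 2) ^ 4 * bern n k x
        ≤ (128 / n ^ 4 * (k - n * x) ^ 4 + 8 / (n - 1) ^ 4) * bern n k x := by
          refine mul_le_mul_of_nonneg_right ((hle.trans ?_)) (bern_nonneg hx)
          rw [hkn]
          refine hpow.trans (le_of_eq ?_)
          norm_num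
          ring
      _ = _ := by ring
  rw [sum_sub_pow_four_mul_bern, sum_bern] at key
  have hm : (n : ℝ) * (x * (1 - x)) * (1 + 3 * (n - 2) * (x * (1 - x))) ≤ 4 * n ^ 2 := by
    have : (n : ℝ) * (x * (1 - x)) ≤ n := mul_le_of_le_one_right h₀.le hx₁
    have h3 : 3 * ((n : ℝ) - 2) * (x * (1 - x)) ≤ 3 * (n - 2) :=
      mul_le_of_le_one_right (by linarith) hx₁
    have h4 : 0 ≤ 3 * ((n : ℝ) - 2) * (x * (1 - x)) := mul_nonneg (by linarith) hx₀
    calc _ ≤ (n : ℝ) * (4 * n) := mul_le_mul this (by linarith) (by linarith) h₀.le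
      _ = _ := by ring
  calc n * ∑ k ∈ range (n + 1), (akrNode n k ^ 2 - x ^ 2) ^ 4 * bern n k x
      ≤ n * (128 / n ^ 4 * (4 * n ^ 2) + 8 / (n - 1) ^ 4 * 1) := by
        refine mul_le_mul_of_nonneg_left (key.trans ?_) h₀.le
        gcongr
    _ = 512 / n + 8 * n / (n - 1) ^ 4 := by
        field_simp
        ring
    _ ≤ 512 / (n - 1) + 16 / (n - 1) := by
        refine add_le_add (div_le_div_of_nonneg_left (by norm_num) h₁ (by linarith)) ?_
        rw [div_le_div_iff₀ (by positivity) h₁]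
        have : (1 : ℝ) ≤ (n - 1) ^ 2 := one_le_pow₀ (by linarith)
        nlinarith [mul_le_mul_of_nonneg_left this (by positivity : (0 : ℝ) ≤ (n - 1) ^ 2)]
    _ = _ := by ring

/-- Second-order Taylor expansion at `x` in the variable `t ^ 2`, with a remainder bound valid
on the whole unit interval. -/
lemma exists_abs_sub_sq_expansion_le {x : ℝ} (hx : x ∈ Set.Ioc (0 : ℝ) 1) {f : ℝ → ℝ}
    (hf : ContDiffOn ℝ 2 f (Set.Icc 0 1)) {d₁ d₂ a b : ℝ}
    (hd₁ : derivWithin f (Set.Icc 0 1) x = d₁)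
    (hd₂ : derivWithin (fun t => derivWithin f (Set.Icc 0 1) t) (Set.Icc 0 1) x = d₂)
    (ha : 2 * x * a = d₁) (hb : a + 4 * x ^ 2 * b = d₂ / 2) {ε : ℝ} (hε : 0 < ε) :
    ∃ C, 0 ≤ C ∧ ∀ t ∈ Set.Icc (0 : ℝ) 1,
      |f t - f x - a * (t ^ 2 - x ^ 2) - b * (t ^ 2 - x ^ 2) ^ 2|
        ≤ ε * (t ^ 2 - x ^ 2) ^ 2 + C * (t ^ 2 - x ^ 2) ^ 4 := by
  have hx₀ := hx.1
  have hxI : x ∈ Set.Icc (0 : ℝ) 1 := ⟨hx.1.le, hx.2⟩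
  set R : ℝ → ℝ := fun t => f t - f x - a * (t ^ 2 - x ^ 2) - b * (t ^ 2 - x ^ 2) ^ 2 with hR
  have hRcont : ContinuousOn R (Set.Icc 0 1) := by
    have := hf.continuousOn
    fun_prop
  obtain ⟨M, hM⟩ := isCompact_Icc.exists_bound_of_continuousOn hRcont
  have hM₀ : 0 ≤ M := (norm_nonneg _).trans (hM x hxI)
  have hgap : ∀ t ∈ Set.Icc (0 : ℝ) 1, x * |t - x| ≤ |t ^ 2 - x ^ 2| := by
    intro t ht
    rw [sq_sub_sq, abs_mul, abs_of_nonneg (by linarith [ht.1] : 0 ≤ t + x)]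
    exact mul_le_mul_of_nonneg_right (by linarith [ht.1]) (abs_nonneg _)
  have htaylor : (fun t => f t - taylorWithinEval f 2 (Set.Icc 0 1) x t)
      =o[nhdsWithin x (Set.Icc 0 1)] fun t => (t - x) ^ 2 :=
    taylor_isLittleO (n := 2) (convex_Icc 0 1) hxI hf
  have hiter : iteratedDerivWithin 2 f (Set.Icc 0 1) x = d₂ := by
    have h₁ : iteratedDerivWithin 1 f (Set.Icc 0 1)
        = fun t => derivWithin f (Set.Icc 0 1) t := by
      funext t
      simp
    rw [iteratedDerivWithin_succ, h₁, hd₂]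
  have hrest : (fun t => -b * ((4 * x + (t - x)) * (t - x)) * (t - x) ^ 2)
      =o[nhdsWithin x (Set.Icc 0 1)] fun t => (t - x) ^ 2 := by
    have hc : Tendsto (fun t => -b * ((4 * x + (t - x)) * (t - x)))
        (nhdsWithin x (Set.Icc 0 1)) (nhds 0) := by
      have : Continuous fun t : ℝ => -b * ((4 * x + (t - x)) * (t - x)) := by fun_prop
      simpa using (this.tendsto x).mono_left nhdsWithin_le_nhds
    simpa using ((Asymptotics.isLittleO_one_iff ℝ).2 hc).mul_isBigO
      (Asymptotics.isBigO_refl (fun t => (t - x) ^ 2) (nhdsWithin x (Set.Icc 0 1)))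
  have hRo : R =o[nhdsWithin x (Set.Icc 0 1)] fun t => (t - x) ^ 2 := by
    refine (htaylor.add hrest).congr_left fun t => ?_
    simp only [hR, taylorWithinEval_succ, taylor_within_zero_eval, hiter, smul_eq_mul]
    norm_num [Nat.factorial, hd₁]
    linear_combination (t - x) * ha + (t - x) ^ 2 * hb
  have hnear := hRo.def (show 0 < ε * x ^ 2 by positivity)
  obtain ⟨δ, hδ, hball⟩ := Metric.mem_nhdsWithin_iff.1 hnear
  refine ⟨M / (x * δ) ^ 4, by positivity, fun t ht => ?_⟩
  have hsq : x ^ 2 * (t - x) ^ 2 ≤ (t ^ 2 - x ^ 2) ^ 2 := by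
    have := pow_le_pow_left₀ (by positivity) (hgap t ht) 2
    rwa [mul_pow, sq_abs, sq_abs] at this
  rcases lt_or_ge |t - x| δ with h | h
  · have := hball ⟨by simpa [Real.dist_eq] using h, ht⟩
    simp only [Set.mem_ofPred_eq, Real.norm_eq_abs, abs_pow, sq_abs] at this
    have hC : 0 ≤ M / (x * δ) ^ 4 * (t ^ 2 - x ^ 2) ^ 4 := by positivity
    calc |R t| ≤ ε * x ^ 2 * (t - x) ^ 2 := this
      _ = ε * (x ^ 2 * (t - x) ^ 2) := by ring
      _ ≤ ε * (t ^ 2 - x ^ 2) ^ 2 := mul_le_mul_of_nonneg_left hsq hε.le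
      _ ≤ _ := le_add_of_nonneg_right hC
  · have h4 : (x * δ) ^ 4 ≤ (t ^ 2 - x ^ 2) ^ 4 := by
      rw [← (by decide : Even 4).pow_abs (t ^ 2 - x ^ 2)]
      exact pow_le_pow_left₀ (by positivity)
        ((mul_le_mul_of_nonneg_left h hx₀.le).trans (hgap t ht)) 4
    have hε₂ : 0 ≤ ε * (t ^ 2 - x ^ 2) ^ 2 := by positivity
    calc |R t| ≤ M := hM t ht
      _ = M / (x * δ) ^ 4 * (x * δ) ^ 4 := by field_simp
      _ ≤ M / (x * δ) ^ 4 * (t ^ 2 - x ^ 2) ^ 4 := by gcongr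
      _ ≤ _ := le_add_of_nonneg_left hε₂

lemma tendsto_mul_sum_akrNode_sq_sub_sq (x : ℝ) :
    Tendsto (fun n : ℕ => n * ∑ k ∈ range (n + 1), (akrNode n k ^ 2 - x ^ 2) ^ 2 * bern n k x)
      atTop (nhds (4 * x ^ 3 * (1 - x))) := by
  have hinf : Tendsto (fun n : ℕ => (n : ℝ) - 1) atTop atTop :=
    tendsto_atTop_add_const_right _ _ tendsto_natCast_atTop_atTop
  have h := (hinf.const_div_atTop (2 * x ^ 2 - 4 * x ^ 3 + 2 * x ^ 4)).const_add
    (4 * x ^ 3 * (1 - x))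
  rw [add_zero] at h
  refine h.congr' ?_
  filter_upwards [eventually_ge_atTop 2] with n hn
  exact (mul_sum_akrNode_sq_sub_sq hn x).symm

/-- If `R` is `o((t ^ 2 - x ^ 2) ^ 2)` in the sense of the given bound, its image under the
operator is `o(1 / n)`. -/
lemma tendsto_mul_akrOp_zero {x : ℝ} (hx : x ∈ Set.Ioc (0 : ℝ) 1) {R : ℝ → ℝ}
    (hR : ∀ ε > 0, ∃ C, 0 ≤ C ∧ ∀ t ∈ Set.Icc (0 : ℝ) 1,
      |R t| ≤ ε * (t ^ 2 - x ^ 2) ^ 2 + C * (t ^ 2 - x ^ 2) ^ 4) :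
    Tendsto (fun n : ℕ => (n : ℝ) * akrOp n R x) atTop (nhds 0) := by
  rw [Metric.tendsto_nhds]
  intro η hη
  set L := 4 * x ^ 3 * (1 - x) with hL
  have hL₀ : 0 ≤ L := mul_nonneg (by have := hx.1; positivity) (by linarith [hx.2])
  obtain ⟨C, hC, hRC⟩ := hR (η / (2 * (L + 1))) (by positivity)
  have hinf : Tendsto (fun n : ℕ => (n : ℝ) - 1) atTop atTop :=
    tendsto_atTop_add_const_right _ _ tendsto_natCast_atTop_atTop
  have hfourth := (hinf.const_div_atTop 528).const_mul C
  rw [mul_zero] at hfourth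
  filter_upwards [eventually_ge_atTop 2,
    (tendsto_mul_sum_akrNode_sq_sub_sq x).eventually_lt_const (lt_add_one L),
    hfourth.eventually_lt_const (half_pos hη)] with n hn h₂ h₄
  rw [Real.dist_eq, sub_zero, abs_mul, Nat.abs_cast]
  have hsum : |akrOp n R x| ≤ η / (2 * (L + 1))
        * ∑ k ∈ range (n + 1), (akrNode n k ^ 2 - x ^ 2) ^ 2 * bern n k x
      + C * ∑ k ∈ range (n + 1), (akrNode n k ^ 2 - x ^ 2) ^ 4 * bern n k x := by
    rw [mul_sum, mul_sum, ← sum_add_distrib]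
    refine (abs_sum_le_sum_abs _ _).trans (sum_le_sum fun k hk => ?_)
    rw [abs_mul, abs_of_nonneg (bern_nonneg hx), ← mul_assoc, ← mul_assoc, ← add_mul]
    exact mul_le_mul_of_nonneg_right
      (hRC _ (akrNode_mem_Icc hn (Nat.lt_succ_iff.1 (mem_range.1 hk)))) (bern_nonneg hx)
  calc (n : ℝ) * |akrOp n R x| ≤ n * _ := mul_le_mul_of_nonneg_left hsum n.cast_nonneg
    _ = η / (2 * (L + 1))
          * (n * ∑ k ∈ range (n + 1), (akrNode n k ^ 2 - x ^ 2) ^ 2 * bern n k x)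
        + C * (n * ∑ k ∈ range (n + 1), (akrNode n k ^ 2 - x ^ 2) ^ 4 * bern n k x) := by ring
    _ ≤ η / (2 * (L + 1)) * (L + 1) + C * (528 / (n - 1)) :=
        add_le_add (mul_le_mul_of_nonneg_left h₂.le (by positivity))
          (mul_le_mul_of_nonneg_left (mul_sum_akrNode_sq_sub_pow_four_le hn hx) hC)
    _ < η / 2 + η / 2 := by
        refine add_lt_add_of_le_of_lt (le_of_eq ?_) h₄
        field_simp
    _ = η := add_halves η

theorem stmt_8 (x : ℝ) (hx : x ∈ Set.Ioc (0 : ℝ) 1) (f : ℝ → ℝ)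
    (hf : ContDiffOn ℝ 2 f (Set.Icc 0 1)) :
    Tendsto (fun n : ℕ => (n : ℝ) * (akrOp n f x - f x)) atTop
      (nhds (x * (1 - x) / 2 * derivWithin (fun t => derivWithin f (Set.Icc 0 1) t) (Set.Icc 0 1) x
        - (1 - x) / 2 * derivWithin f (Set.Icc 0 1) x)) := by
  have hx₀ : x ≠ 0 := hx.1.ne'
  set d₁ := derivWithin f (Set.Icc 0 1) x with hd₁
  set d₂ := derivWithin (fun t => derivWithin f (Set.Icc 0 1) t) (Set.Icc 0 1) x with hd₂
  set a := d₁ / (2 * x) with ha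
  set b := (d₂ / 2 - a) / (4 * x ^ 2) with hb
  have hrem := tendsto_mul_akrOp_zero hx (R := fun t =>
      f t - f x - a * (t ^ 2 - x ^ 2) - b * (t ^ 2 - x ^ 2) ^ 2) fun ε hε =>
    exists_abs_sub_sq_expansion_le hx hf hd₁.symm hd₂.symm
      (by rw [ha]; field_simp) (by rw [hb]; field_simp; ring) hε
  have hlim := ((tendsto_mul_sum_akrNode_sq_sub_sq x).const_mul b).add hrem
  have hval : b * (4 * x ^ 3 * (1 - x)) + 0 = x * (1 - x) / 2 * d₂ - (1 - x) / 2 * d₁ := by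
    rw [hb, ha]
    field_simp
    ring
  rw [hval] at hlim
  refine hlim.congr' ?_
  filter_upwards [eventually_ge_atTop 2] with n hn
  have hdecomp : akrOp n f x = f x * ∑ k ∈ range (n + 1), bern n k x
      + a * ∑ k ∈ range (n + 1), (akrNode n k ^ 2 - x ^ 2) * bern n k x
      + b * ∑ k ∈ range (n + 1), (akrNode n k ^ 2 - x ^ 2) ^ 2 * bern n k x
      + akrOp n (fun t => f t - f x - a * (t ^ 2 - x ^ 2) - b * (t ^ 2 - x ^ 2) ^ 2) x := by
    simp only [akrOp, mul_sum, ← sum_add_distrib]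
    exact sum_congr rfl fun k _ => by ring
  rw [sum_bern, sum_akrNode_sq_sub hn] at hdecomp
  rw [hdecomp]
  ring
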